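/- Let ℘ be the Weierstrass function of a lattice Λ with invariants g₂, g₃, let b₂ ∈ ℂ, and set b₄ = (12(b₂/12)² − g₂)/2 and b₆ = 4(b₂/12)³ − g₂(b₂/12) − g₃. If t₁, t₂ are the two zeros of ℘(z) − b₂/12 in ℂ/Λ (so ℘(t₁) = ℘(t₂) = b₂/12 and t₁ + t₂ = 0), then for all z with z, z−t₁, z−t₂ ∉ Λ and ℘(z) ≠ b₂/12: ℘(z−t₁) + ℘(z−t₂) = b₂/6 + b₄/(℘(z) − b₂/12) + b₆/(℘(z) − b₂/12)². -/

import Mathlib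

open Complex

/-- The set of points of the lattice `ℤω₁ + ℤω₂`. -/
def latticePts (ω₁ ω₂ : ℂ) : Set ℂ := {z | ∃ m n : ℤ, z = (m : ℂ) * ω₁ + (n : ℂ) * ω₂}

/-- The Weierstrass `℘`-function of the lattice `ℤω₁ + ℤω₂`. -/
noncomputable def wp (ω₁ ω₂ : ℂ) (z : ℂ) : ℂ :=
  1 / z ^ 2 + ∑' p : {p : ℤ × ℤ // p ≠ 0},
    (1 / (z - ((p.1.1 : ℂ) * ω₁ + (p.1.2 : ℂ) * ω₂)) ^ 2 -
      1 / ((p.1.1 : ℂ) * ω₁ + (p.1.2 : ℂ) * ω₂) ^ 2)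

open Filter Topology PeriodPair

section LocalLimits

/-- A meromorphic function `f` with `z f(z) → 0` as `z → 0` has a limit at `0`. -/
lemma exists_tendsto_of_tendsto_id_mul {f : ℂ → ℂ} (hf : MeromorphicAt f 0)
    (h : Tendsto (fun z ↦ z * f z) (𝓝[≠] 0) (𝓝 0)) : ∃ c, Tendsto f (𝓝[≠] 0) (𝓝 c) := by
  have hid : MeromorphicAt (id : ℂ → ℂ) 0 := MeromorphicAt.id 0
  have hpos := (tendsto_zero_iff_meromorphicOrderAt_pos (hid.mul hf)).1 h
  rw [meromorphicOrderAt_mul hid hf, meromorphicOrderAt_id] at hpos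
  rw [tendsto_nhds_iff_meromorphicOrderAt_nonneg hf]
  cases ho : meromorphicOrderAt f 0 with
  | top => exact le_top
  | coe n =>
    rw [ho] at hpos
    norm_cast at hpos ⊢
    lia

lemma tendsto_neg_nhdsNE_zero : Tendsto (fun z : ℂ ↦ -z) (𝓝[≠] 0) (𝓝[≠] 0) := by
  refine tendsto_nhdsWithin_iff.2 ⟨?_, ?_⟩
  · simpa using (continuous_neg.tendsto (0 : ℂ)).mono_left nhdsWithin_le_nhds
  · filter_upwards [self_mem_nhdsWithin] with z hz
    simpa using hz

/-- An even meromorphic function `f` with `z² f(z) → 0` as `z → 0` has a limit at `0`. -/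
lemma exists_tendsto_of_even {f : ℂ → ℂ} (hf : MeromorphicAt f 0) (heven : f.Even)
    (h : Tendsto (fun z ↦ z ^ 2 * f z) (𝓝[≠] 0) (𝓝 0)) : ∃ c, Tendsto f (𝓝[≠] 0) (𝓝 c) := by
  obtain ⟨c, hc⟩ := exists_tendsto_of_tendsto_id_mul (f := fun z ↦ z * f z) (by fun_prop)
    (by simpa [← mul_assoc, ← sq] using h)
  refine exists_tendsto_of_tendsto_id_mul hf ?_
  have hodd : Tendsto (fun z ↦ z * f z) (𝓝[≠] 0) (𝓝 (-c)) := by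
    refine ((hc.comp tendsto_neg_nhdsNE_zero).neg).congr fun z ↦ ?_
    simp [heven z]
  have : c = 0 := CharZero.eq_neg_self_iff.1 (tendsto_nhds_unique hc hodd)
  rwa [this] at hc

lemma tendsto_comp_add_nhdsNE {f : ℂ → ℂ} {x a : ℂ} {F : Filter ℂ}
    (h : Tendsto f (𝓝[≠] (x + a)) F) : Tendsto (fun z ↦ f (z + a)) (𝓝[≠] x) F := by
  refine h.comp (tendsto_nhdsWithin_iff.2 ⟨?_, ?_⟩)
  · exact ((continuous_add_const a).tendsto x).mono_left nhdsWithin_le_nhds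
  · filter_upwards [self_mem_nhdsWithin] with z hz
    simpa using hz

end LocalLimits

namespace PeriodPair

variable (L : PeriodPair)

/-- **Liouville's theorem for elliptic functions**: a meromorphic function that is periodic with
respect to a lattice and has a finite limit at every point is constant up to removable
singularities. -/
lemma exists_forall_tendsto_of_periodic {f : ℂ → ℂ} (hf : Meromorphic f)
    (hper : ∀ l ∈ L.lattice, ∀ z, f (z + l) = f z)
    (hlim : ∀ x, ∃ c, Tendsto f (𝓝[≠] x) (𝓝 c)) : ∃ d, ∀ x, Tendsto f (𝓝[≠] x) (𝓝 d) := by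
  have hfU : MeromorphicOn f Set.univ := fun x _ ↦ hf x
  set g := toMeromorphicNFOn f Set.univ with hg
  have heq (x : ℂ) : f =ᶠ[𝓝[≠] x] g :=
    (hfU.toMeromorphicNFOn_eq_self_on_nhdsNE (Set.mem_univ x)).symm
  have han (x : ℂ) : AnalyticAt ℂ g x := by
    rw [← (meromorphicNFOn_toMeromorphicNFOn f Set.univ
      (Set.mem_univ x)).meromorphicOrderAt_nonneg_iff_analyticAt,
      ← meromorphicOrderAt_congr (heq x)]
    exact (tendsto_nhds_iff_meromorphicOrderAt_nonneg (hf x)).1 (hlim x)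
  have htend (x : ℂ) : Tendsto f (𝓝[≠] x) (𝓝 (g x)) :=
    ((han x).continuousAt.tendsto.mono_left nhdsWithin_le_nhds).congr' (heq x).symm
  have hgper (x l : ℂ) (hl : l ∈ L.lattice) : g (x + l) = g x := by
    refine tendsto_nhds_unique ?_ (htend x)
    exact (tendsto_comp_add_nhdsNE (htend (x + l))).congr (hper l hl)
  have hdiff : Differentiable ℂ g := fun x ↦ (han x).differentiableAt
  refine ⟨g 0, fun x ↦ ?_⟩
  rw [← hdiff.apply_eq_apply_of_bounded (IsZLattice.isCompact_range_of_periodic L.lattice _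
    hdiff.continuous fun z w hw ↦ hgper z w hw).isBounded x 0]
  exact htend x

lemma tendsto_sq_mul_weierstrassP : Tendsto (fun z ↦ z ^ 2 * ℘[L] z) (𝓝[≠] 0) (𝓝 1) := by
  have hcont : ContinuousAt ℘[L - (0 : ℂ)] 0 := (L.analyticAt_weierstrassPExcept 0).continuousAt
  have : Tendsto (fun z ↦ z ^ 2 * ℘[L - (0 : ℂ)] z + 1) (𝓝[≠] 0) (𝓝 1) := by
    have h : ContinuousAt (fun z ↦ z ^ 2 * ℘[L - (0 : ℂ)] z + 1) 0 := by fun_prop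
    simpa [ContinuousAt] using h.tendsto.mono_left (nhdsWithin_le_nhds (s := {0}ᶜ))
  refine this.congr' ?_
  filter_upwards [self_mem_nhdsWithin] with z (hz : z ≠ 0)
  rw [← L.weierstrassPExcept_add 0 z]
  simp
  field_simp

lemma weierstrassP_add_of_mem {l : ℂ} (hl : l ∈ L.lattice) (z : ℂ) : ℘[L] (z + l) = ℘[L] z :=
  L.weierstrassP_add_coe z ⟨l, hl⟩

lemma hasDerivAt_weierstrassP {t : ℂ} (ht : t ∉ L.lattice) :
    HasDerivAt ℘[L] (℘'[L] t) t := by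
  rw [← L.deriv_weierstrassP]
  exact (L.analyticOnNhd_weierstrassP t ht).differentiableAt.hasDerivAt

/-- The defect of the symmetric form of the sum formula for `℘(z - t) + ℘(z + t)`. -/
noncomputable def sumDefect (g₂ g₃ t z : ℂ) : ℂ :=
  (℘[L] z - ℘[L] t) ^ 2 * (℘[L] (z - t) + ℘[L] (z + t)) -
    ((℘[L] z + ℘[L] t) * (2 * ℘[L] z * ℘[L] t - g₂ / 2) - g₃)

variable (g₂ g₃ : ℂ)

lemma sumDefect_comm (t z : ℂ) : L.sumDefect g₂ g₃ t z = L.sumDefect g₂ g₃ z t := by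
  simp only [sumDefect]
  rw [← L.weierstrassP_neg (z - t), neg_sub, add_comm z t]
  ring

lemma sumDefect_even (t : ℂ) : (L.sumDefect g₂ g₃ t).Even := by
  intro z
  simp only [sumDefect, L.weierstrassP_neg]
  rw [← L.weierstrassP_neg (-z - t), ← L.weierstrassP_neg (-z + t), show -(-z - t) = z + t by ring,
    show -(-z + t) = z - t by ring]
  ring

lemma sumDefect_add_of_mem (t : ℂ) {l : ℂ} (hl : l ∈ L.lattice) (z : ℂ) :
    L.sumDefect g₂ g₃ t (z + l) = L.sumDefect g₂ g₃ t z := by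
  simp only [sumDefect, add_sub_right_comm, add_right_comm z l t, L.weierstrassP_add_of_mem hl]

lemma meromorphic_sumDefect (t : ℂ) : Meromorphic (L.sumDefect g₂ g₃ t) := by
  have hsub : Meromorphic fun z ↦ ℘[L] (z - t) := fun x ↦
    (L.meromorphic_weierstrassP (x - t)).comp_analyticAt (g := (· - t)) (by fun_prop)
  have hadd : Meromorphic fun z ↦ ℘[L] (z + t) := fun x ↦
    (L.meromorphic_weierstrassP (x + t)).comp_analyticAt (g := (· + t)) (by fun_prop)
  unfold sumDefect
  fun_prop

lemma exists_tendsto_sq_mul_sumDefect {t : ℂ} (ht : t ∉ L.lattice) :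
    ∃ c, Tendsto (fun z ↦ z ^ 2 * L.sumDefect g₂ g₃ t z) (𝓝[≠] 0) (𝓝 c) := by
  have hsub : AnalyticAt ℂ (fun z ↦ ℘[L] (z - t)) 0 :=
    (L.analyticOnNhd_weierstrassP (0 - t) (by simpa using ht)).fun_comp (f := fun z ↦ z - t)
      (by fun_prop)
  have hadd : AnalyticAt ℂ (fun z ↦ ℘[L] (z + t)) 0 :=
    (L.analyticOnNhd_weierstrassP (0 + t) (by simpa using ht)).fun_comp (f := fun z ↦ z + t)
      (by fun_prop)
  set a : ℂ → ℂ := fun z ↦ ℘[L] (z - t) + ℘[L] (z + t) - 2 * ℘[L] t with ha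
  have haan : AnalyticAt ℂ a 0 := by fun_prop
  have ha0 : a 0 = 0 := by simp [ha, L.weierstrassP_neg]; ring
  obtain ⟨b, hb⟩ := exists_tendsto_of_even (f := fun z ↦ a z / z ^ 2)
    (by have := haan.meromorphicAt; fun_prop)
    (by
      intro z
      simp only [ha]
      rw [← L.weierstrassP_neg (-z - t), ← L.weierstrassP_neg (-z + t),
        show -(-z - t) = z + t by ring, show -(-z + t) = z - t by ring]
      ring)
    (by
      have h := haan.continuousAt.tendsto.mono_left (nhdsWithin_le_nhds (s := {0}ᶜ))
      rw [ha0] at h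
      refine h.congr' ?_
      filter_upwards [self_mem_nhdsWithin] with z (hz : z ≠ 0)
      field_simp)
  have hz : Tendsto (fun z : ℂ ↦ z ^ 2) (𝓝[≠] 0) (𝓝 0) := by
    simpa using ((continuous_pow 2).tendsto (0 : ℂ)).mono_left (nhdsWithin_le_nhds (s := {0}ᶜ))
  have hP := L.tendsto_sq_mul_weierstrassP
  have key := (((hP.sub (hz.mul_const (℘[L] t))).pow 2).mul hb).add
    ((hP.const_mul (g₂ / 2 - 6 * ℘[L] t ^ 2)).add
      (hz.mul_const (2 * ℘[L] t ^ 3 + g₂ / 2 * ℘[L] t + g₃)))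
  refine ⟨_, key.congr' ?_⟩
  filter_upwards [self_mem_nhdsWithin] with z (hz : z ≠ 0)
  simp only [sumDefect, ha]
  field_simp
  ring

lemma tendsto_sumDefect_self {t : ℂ} (ht : t ∉ L.lattice)
    (hrel : ℘'[L] t ^ 2 = 4 * ℘[L] t ^ 3 - g₂ * ℘[L] t - g₃) :
    Tendsto (L.sumDefect g₂ g₃ t) (𝓝[≠] t) (𝓝 0) := by
  have hderiv := L.hasDerivAt_weierstrassP ht
  have hP : Tendsto ℘[L] (𝓝[≠] t) (𝓝 (℘[L] t)) :=
    hderiv.continuousAt.tendsto.mono_left nhdsWithin_le_nhds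
  have hpole : Tendsto (fun z ↦ (z - t) ^ 2 * ℘[L] (z - t)) (𝓝[≠] t) (𝓝 1) := by
    have := L.tendsto_sq_mul_weierstrassP
    rw [← add_neg_cancel t] at this
    simpa [sub_eq_add_neg] using tendsto_comp_add_nhdsNE this
  have hprod : Tendsto (fun z ↦ (℘[L] z - ℘[L] t) ^ 2 * ℘[L] (z - t)) (𝓝[≠] t)
      (𝓝 (℘'[L] t ^ 2)) := by
    have := (hderiv.tendsto_slope.pow 2).mul hpole
    rw [mul_one] at this
    refine this.congr' ?_
    filter_upwards [self_mem_nhdsWithin] with z (hz : z ≠ t)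
    have : z - t ≠ 0 := sub_ne_zero.2 hz
    rw [slope_def_field]
    field_simp
  have hsum : Tendsto (fun z ↦ (℘[L] z - ℘[L] t) ^ 2 * (℘[L] (z - t) + ℘[L] (z + t))) (𝓝[≠] t)
      (𝓝 (℘'[L] t ^ 2)) := by
    by_cases h2 : t + t ∈ L.lattice
    · have h0 : ℘'[L] t = 0 := by
        rw [← CharZero.eq_neg_self_iff, ← L.derivWeierstrassP_neg,
          ← L.derivWeierstrassP_add_coe (-t) ⟨_, h2⟩]
        simp
      rw [h0] at hprod ⊢
      have := hprod.const_mul 2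
      simp only [ne_eq, OfNat.ofNat_ne_zero, not_false_eq_true, zero_pow, mul_zero] at this ⊢
      refine this.congr fun z ↦ ?_
      rw [show z + t = z - t + (t + t) by ring, L.weierstrassP_add_of_mem h2]
      ring
    · have hadd : Tendsto (fun z ↦ ℘[L] (z + t)) (𝓝[≠] t) (𝓝 (℘[L] (t + t))) :=
        tendsto_comp_add_nhdsNE ((L.hasDerivAt_weierstrassP h2).continuousAt.tendsto.mono_left
          nhdsWithin_le_nhds)
      have := hprod.add (((hP.sub_const (℘[L] t)).pow 2).mul hadd)
      simp only [sub_self, ne_eq, OfNat.ofNat_ne_zero, not_false_eq_true, zero_pow, zero_mul,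
        add_zero] at this
      exact this.congr fun z ↦ by ring
  have hrest := ((hP.add_const (℘[L] t)).mul
    (((hP.const_mul 2).mul_const (℘[L] t)).sub_const (g₂ / 2))).sub_const g₃
  have := hsum.sub hrest
  rw [hrel] at this
  convert! this using 2
  ring

lemma analyticAt_sumDefect {t x : ℂ} (hx : x ∉ L.lattice) (hsub : x - t ∉ L.lattice)
    (hadd : x + t ∉ L.lattice) : AnalyticAt ℂ (L.sumDefect g₂ g₃ t) x := by
  have h := L.analyticOnNhd_weierstrassP x hx
  have hs : AnalyticAt ℂ (fun z ↦ ℘[L] (z - t)) x :=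
    (L.analyticOnNhd_weierstrassP (x - t) hsub).fun_comp (f := fun z ↦ z - t) (by fun_prop)
  have ha : AnalyticAt ℂ (fun z ↦ ℘[L] (z + t)) x :=
    (L.analyticOnNhd_weierstrassP (x + t) hadd).fun_comp (f := fun z ↦ z + t) (by fun_prop)
  unfold sumDefect
  fun_prop

/-- Two points with distinct `℘`-values have neither difference nor sum in the lattice. -/
lemma sub_notMem_and_add_notMem {t z : ℂ} (hne : ℘[L] z ≠ ℘[L] t) :
    z - t ∉ L.lattice ∧ z + t ∉ L.lattice := by
  refine ⟨fun h ↦ hne ?_, fun h ↦ hne ?_⟩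
  · rw [← L.weierstrassP_add_of_mem h t]
    simp
  · rw [← L.weierstrassP_neg t, ← L.weierstrassP_add_of_mem h (-t)]
    simp

/-- The defect of the sum formula is a constant multiple of `℘(z) - ℘(t)`. -/
lemma exists_sumDefect_eq {t : ℂ} (ht : t ∉ L.lattice)
    (hrel : ℘'[L] t ^ 2 = 4 * ℘[L] t ^ 3 - g₂ * ℘[L] t - g₃) :
    ∃ c, ∀ z ∉ L.lattice, ℘[L] z ≠ ℘[L] t →
      L.sumDefect g₂ g₃ t z = c * (℘[L] z - ℘[L] t) := by
  obtain ⟨c, hc⟩ := L.exists_tendsto_sq_mul_sumDefect g₂ g₃ ht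
  set F : ℂ → ℂ := fun z ↦ L.sumDefect g₂ g₃ t z - c * ℘[L] z with hF
  have hFmer : Meromorphic F := by
    have := L.meromorphic_sumDefect g₂ g₃ t
    fun_prop
  have hFeven : F.Even := fun z ↦ by
    simp only [hF, L.sumDefect_even g₂ g₃ t z, L.weierstrassP_neg]
  have hFper (l : ℂ) (hl : l ∈ L.lattice) (z : ℂ) : F (z + l) = F z := by
    simp only [hF, L.sumDefect_add_of_mem g₂ g₃ t hl, L.weierstrassP_add_of_mem hl]
  have hF0 : ∃ a, Tendsto F (𝓝[≠] 0) (𝓝 a) := by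
    refine exists_tendsto_of_even (hFmer 0) hFeven ?_
    have := hc.sub (L.tendsto_sq_mul_weierstrassP.const_mul c)
    rw [mul_one, sub_self] at this
    exact this.congr fun z ↦ by simp only [hF]; ring
  have hP : ContinuousAt ℘[L] t := (L.hasDerivAt_weierstrassP ht).continuousAt
  have hFt : Tendsto F (𝓝[≠] t) (𝓝 (-(c * ℘[L] t))) := by
    rw [← zero_sub]
    exact (L.tendsto_sumDefect_self g₂ g₃ ht hrel).sub
      ((hP.tendsto.mono_left nhdsWithin_le_nhds).const_mul c)
  have hFan (x : ℂ) (hx : x ∉ L.lattice) (hsub : x - t ∉ L.lattice) (hadd : x + t ∉ L.lattice) :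
      Tendsto F (𝓝[≠] x) (𝓝 (F x)) := by
    have h := (L.analyticAt_sumDefect g₂ g₃ hx hsub hadd).continuousAt
    have hPx : ContinuousAt ℘[L] x := (L.hasDerivAt_weierstrassP hx).continuousAt
    have : ContinuousAt F x := by fun_prop
    exact this.tendsto.mono_left nhdsWithin_le_nhds
  have htranslate (x y : ℂ) (hxy : x - y ∈ L.lattice) (h : ∃ a, Tendsto F (𝓝[≠] y) (𝓝 a)) :
      ∃ a, Tendsto F (𝓝[≠] x) (𝓝 a) := by
    obtain ⟨a, ha⟩ := h
    refine ⟨a, ?_⟩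
    have hl : y - x ∈ L.lattice := by simpa using neg_mem hxy
    exact (tendsto_comp_add_nhdsNE (x := x) (a := y - x) (by simpa using ha)).congr (hFper _ hl)
  have hFnegt : ∃ a, Tendsto F (𝓝[≠] (-t)) (𝓝 a) := by
    refine ⟨_, (hFt.comp (tendsto_nhdsWithin_iff.2 ⟨?_, ?_⟩)).congr hFeven⟩
    · simpa using (continuous_neg.tendsto (-t)).mono_left nhdsWithin_le_nhds
    · filter_upwards [self_mem_nhdsWithin] with z (hz : z ≠ -t)
      simpa [neg_eq_iff_eq_neg] using hz
  obtain ⟨d, hd⟩ := L.exists_forall_tendsto_of_periodic hFmer hFper fun x ↦ by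
    by_cases hx : x ∈ L.lattice
    · exact htranslate x 0 (by simpa using hx) hF0
    by_cases hsub : x - t ∈ L.lattice
    · exact htranslate x t hsub ⟨_, hFt⟩
    by_cases hadd : x + t ∈ L.lattice
    · exact htranslate x (-t) (by simpa using hadd) hFnegt
    exact ⟨_, hFan x hx hsub hadd⟩
  refine ⟨c, fun z hz hne ↦ ?_⟩
  obtain ⟨hsub, hadd⟩ := L.sub_notMem_and_add_notMem hne
  have h := (tendsto_nhds_unique (hFan z hz hsub hadd) (hd z)).trans
    (tendsto_nhds_unique (hd t) hFt)
  simp only [hF] at h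
  linear_combination h

/-- The Weierstrass function takes a value outside any given pair. -/
lemma exists_weierstrassP_ne_ne (a b : ℂ) :
    ∃ w ∉ L.lattice, ℘[L] w ≠ a ∧ ℘[L] w ≠ b := by
  have hcob : Tendsto ℘[L] (𝓝[≠] 0) (Bornology.cobounded ℂ) :=
    tendsto_cobounded_of_meromorphicOrderAt_neg <| by
      rw [L.order_weierstrassP 0 L.lattice.zero_mem]
      decide
  obtain ⟨w, hwa, hwb, hw0⟩ := ((hcob.eventually_ne_cobounded a).and
    ((hcob.eventually_ne_cobounded b).and (hcob.eventually_ne_cobounded 0))).exists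
  exact ⟨w, fun h ↦ hw0 (L.weierstrassP_coe ⟨w, h⟩), hwa, hwb⟩

lemma sumDefect_eq_zero
    (hrel : ∀ z ∉ L.lattice, ℘'[L] z ^ 2 = 4 * ℘[L] z ^ 3 - g₂ * ℘[L] z - g₃)
    {t z : ℂ} (ht : t ∉ L.lattice) (hz : z ∉ L.lattice) (hne : ℘[L] z ≠ ℘[L] t) :
    L.sumDefect g₂ g₃ t z = 0 := by
  have hex (t : ℂ) (ht : t ∉ L.lattice) := L.exists_sumDefect_eq g₂ g₃ ht (hrel t ht)
  choose! c hc using hex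
  have hanti {t z : ℂ} (ht : t ∉ L.lattice) (hz : z ∉ L.lattice) (hne : ℘[L] z ≠ ℘[L] t) :
      c t = -c z := by
    have h₁ := hc t ht z hz hne
    have h₂ := hc z hz t ht hne.symm
    rw [L.sumDefect_comm, h₂] at h₁
    refine mul_right_cancel₀ (sub_ne_zero.2 hne) ?_
    linear_combination -h₁
  obtain ⟨w, hw, hwt, hwz⟩ := L.exists_weierstrassP_ne_ne (℘[L] t) (℘[L] z)
  have h0 : c t = 0 := by
    linear_combination (hanti ht hz hne + hanti ht hw hwt - hanti hz hw hwz) / 2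
  rw [hc t ht z hz hne, h0, zero_mul]

end PeriodPair

lemma linearIndependent_pair_of_im_div_pos {ω₁ ω₂ : ℂ} (him : 0 < (ω₁ / ω₂).im) :
    LinearIndependent ℝ ![ω₁, ω₂] := by
  have hω₂ : ω₂ ≠ 0 := by
    rintro rfl
    simp at him
  rw [LinearIndependent.pair_iff]
  intro a b h
  have hdiv : (a : ℂ) * (ω₁ / ω₂) + b = 0 := by
    simp only [Complex.real_smul] at h
    field_simp
    linear_combination h
  have ha : a = 0 := by
    have := congrArg Complex.im hdiv
    simpa [him.ne'] using this
  subst ha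
  exact ⟨rfl, by simpa using hdiv⟩

lemma wp_eq_weierstrassP (L : PeriodPair) : wp L.ω₁ L.ω₂ = ℘[L] := by
  funext z
  rw [← L.weierstrassPExcept_add 0 z, wp, add_comm]
  congr 1
  · refine HasSum.tsum_eq ?_
    have h := L.latticeEquivProd.symm.toEquiv.hasSum_iff.2 (L.hasSum_weierstrassPExcept 0 z)
    have h' := (hasSum_subtype_iff_of_support_subset (s := {p : ℤ × ℤ | p ≠ 0})
      (fun p hp ↦ by
        rintro rfl
        simp at hp)).2 h
    refine (congrArg (HasSum · _) (funext fun p ↦ ?_)).mp h'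
    simp [p.2, ← L.latticeEquiv_symm_apply]
  · simp

/-- If `t₁, t₂ = −t₁` are the zeros of `℘(z) − b₂/12`, with
`b₄ = (12(b₂/12)² − g₂)/2` and `b₆ = 4(b₂/12)³ − g₂(b₂/12) − g₃`, then
`℘(z−t₁) + ℘(z−t₂) = b₂/6 + b₄/(℘(z) − b₂/12) + b₆/(℘(z) − b₂/12)²`. -/
theorem wp_sum_translates_formula (ω₁ ω₂ : ℂ) (him : 0 < (ω₁ / ω₂).im) (g₂ g₃ : ℂ)
    (hg : ∀ z : ℂ, z ∉ latticePts ω₁ ω₂ →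
      (deriv (wp ω₁ ω₂) z) ^ 2 = 4 * (wp ω₁ ω₂ z) ^ 3 - g₂ * wp ω₁ ω₂ z - g₃)
    (b₂ b₄ b₆ t₁ t₂ : ℂ)
    (hb₄ : b₄ = (12 * (b₂ / 12) ^ 2 - g₂) / 2)
    (hb₆ : b₆ = 4 * (b₂ / 12) ^ 3 - g₂ * (b₂ / 12) - g₃)
    (ht₁ : t₁ ∉ latticePts ω₁ ω₂) (ht₂ : t₂ = -t₁)
    (hwt₁ : wp ω₁ ω₂ t₁ = b₂ / 12) (hwt₂ : wp ω₁ ω₂ t₂ = b₂ / 12) :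
    ∀ z : ℂ, z ∉ latticePts ω₁ ω₂ → z - t₁ ∉ latticePts ω₁ ω₂ →
      z - t₂ ∉ latticePts ω₁ ω₂ → wp ω₁ ω₂ z ≠ b₂ / 12 →
      wp ω₁ ω₂ (z - t₁) + wp ω₁ ω₂ (z - t₂) =
        b₂ / 6 + b₄ / (wp ω₁ ω₂ z - b₂ / 12) + b₆ / (wp ω₁ ω₂ z - b₂ / 12) ^ 2 := by
  let L : PeriodPair := ⟨ω₁, ω₂, linearIndependent_pair_of_im_div_pos him⟩
  have hP : wp ω₁ ω₂ = ℘[L] := wp_eq_weierstrassP L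
  have hmem (z : ℂ) : z ∈ latticePts ω₁ ω₂ ↔ z ∈ L.lattice := by
    simp only [PeriodPair.mem_lattice, latticePts, Set.mem_ofPred_eq, eq_comm, L]
  simp only [hmem, hP, L.deriv_weierstrassP] at *
  intro z hz _ _ hne
  have h := L.sumDefect_eq_zero g₂ g₃ hg ht₁ hz (by rwa [hwt₁])
  have hne' : ℘[L] z - b₂ / 12 ≠ 0 := sub_ne_zero.2 hne
  simp only [PeriodPair.sumDefect, hwt₁] at h
  rw [ht₂, sub_neg_eq_add, hb₄, hb₆]
  rw [show b₂ / 6 = 2 * (b₂ / 12) by ring]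
  generalize ℘[L] z = x, b₂ / 12 = e at h hne' ⊢
  field_simp
  linear_combination 2 * h
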